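/- Let u ≠ 0 in ℝⁿ, F = {x ∈ ℝⁿ : ⟨x,u⟩ = 0}, and let A be a real symmetric n×n matrix of strict negative type on F but not of negative type on ℝⁿ. Then the negative type gap Γ of A on F satisfies Γ = 2/β, where β = max_{x ∈ {−1,1}ⁿ} ⟨Bx,x⟩ and B = ⟨A⁻¹u,u⟩⁻¹·(A⁻¹u)(A⁻¹u)ᵀ − A⁻¹. -/

import Mathlib

open Matrix

/-- The set of admissible constants for the negative type gap of `A` on
`F = {x : ⟨x,u⟩ = 0}`. The gap `Γ` is the largest element, i.e. the supremum. -/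
def gapSet {n : ℕ} (u : Fin n → ℝ) (A : Matrix (Fin n) (Fin n) ℝ) : Set ℝ :=
  {G : ℝ | 0 ≤ G ∧ ∀ x : Fin n → ℝ, x ⬝ᵥ u = 0 →
    G / 2 * (∑ i, |x i|) ^ 2 + A.mulVec x ⬝ᵥ x ≤ 0}

theorem Matrix.IsSymm.mulVec_dotProduct_comm {m R : Type*} [Fintype m] [CommSemiring R]
    {A : Matrix m m R} (hA : A.IsSymm) (x y : m → R) :
    A *ᵥ x ⬝ᵥ y = A *ᵥ y ⬝ᵥ x := by
  rw [dotProduct_comm, dotProduct_mulVec, ← mulVec_transpose, hA.eq]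

theorem Matrix.IsSymm.mulVec_add_smul_dotProduct_self {m : Type*} [Fintype m]
    {A : Matrix m m ℝ} (hA : A.IsSymm) (x z : m → ℝ) (t : ℝ) :
    A *ᵥ (x + t • z) ⬝ᵥ (x + t • z) =
      A *ᵥ x ⬝ᵥ x + 2 * t * (A *ᵥ z ⬝ᵥ x) + t ^ 2 * (A *ᵥ z ⬝ᵥ z) := by
  simp only [mulVec_add, mulVec_smul, add_dotProduct, dotProduct_add, smul_dotProduct,
    dotProduct_smul, smul_eq_mul]
  rw [hA.mulVec_dotProduct_comm x z]
  ring

/-- Cauchy–Schwarz for a form of negative type on the hyperplane orthogonal to `u`. -/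
theorem sq_mulVec_dotProduct_le {m : Type*} [Fintype m] {u : m → ℝ} {A : Matrix m m ℝ}
    (hA : A.IsSymm) (hneg : ∀ x : m → ℝ, x ⬝ᵥ u = 0 → A *ᵥ x ⬝ᵥ x ≤ 0)
    {x z : m → ℝ} (hx : x ⬝ᵥ u = 0) (hz : z ⬝ᵥ u = 0) :
    (A *ᵥ z ⬝ᵥ x) ^ 2 ≤ (A *ᵥ z ⬝ᵥ z) * (A *ᵥ x ⬝ᵥ x) := by
  have h := discrim_le_zero (a := -(A *ᵥ z ⬝ᵥ z)) (b := -2 * (A *ᵥ z ⬝ᵥ x))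
    (c := -(A *ᵥ x ⬝ᵥ x)) fun t => by
      have h1 := hneg (x + t • z) (by simp [add_dotProduct, hx, hz])
      rw [hA.mulVec_add_smul_dotProduct_self] at h1
      linarith
  rw [discrim] at h
  linarith

/-- A symmetric matrix of strict negative type on a hyperplane but not of negative type on the
whole space is nonsingular. -/
theorem isUnit_det_of_strict_negative_type {m : Type*} [Fintype m] [DecidableEq m] {u : m → ℝ}
    {A : Matrix m m ℝ} (hA : A.IsSymm)
    (hneg : ∀ x : m → ℝ, x ⬝ᵥ u = 0 → A *ᵥ x ⬝ᵥ x ≤ 0)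
    (hstrict : ∀ x : m → ℝ, x ⬝ᵥ u = 0 → A *ᵥ x ⬝ᵥ x = 0 → x = 0)
    (hnot : ∃ w : m → ℝ, 0 < A *ᵥ w ⬝ᵥ w) : IsUnit A.det := by
  rw [isUnit_iff_ne_zero]
  intro hdet
  obtain ⟨z, hz0, hz⟩ := exists_mulVec_eq_zero_iff.mpr hdet
  obtain ⟨w, hw⟩ := hnot
  have hzu : z ⬝ᵥ u ≠ 0 := fun h => hz0 (hstrict z h (by simp [hz]))
  have h := hneg (w + (-(w ⬝ᵥ u) / (z ⬝ᵥ u)) • z) (by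
    rw [add_dotProduct, smul_dotProduct, smul_eq_mul]
    field_simp
    ring)
  rw [hA.mulVec_add_smul_dotProduct_self, hz] at h
  simp only [zero_dotProduct, mul_zero, add_zero] at h
  linarith

theorem finite_setOf_signs_quadratic {m : Type*} [Fintype m] (B : Matrix m m ℝ) :
    {r : ℝ | ∃ x : m → ℝ, (∀ i, x i = 1 ∨ x i = -1) ∧ r = B *ᵥ x ⬝ᵥ x}.Finite := by
  have h : (Set.univ.pi fun _ : m => ({1, -1} : Set ℝ)).Finite :=
    Set.Finite.pi fun _ => Set.toFinite _
  refine (h.image fun x => B *ᵥ x ⬝ᵥ x).subset ?_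
  rintro r ⟨x, hx, rfl⟩
  exact ⟨x, fun i _ => by simpa using hx i, rfl⟩

theorem exists_signs_dotProduct_eq_sum_abs {m : Type*} [Fintype m] (x : m → ℝ) :
    ∃ y : m → ℝ, (∀ i, y i = 1 ∨ y i = -1) ∧ y ⬝ᵥ x = ∑ i, |x i| := by
  refine ⟨fun i => if 0 ≤ x i then 1 else -1, fun i => ?_, Finset.sum_congr rfl fun i _ => ?_⟩
  · dsimp only
    split_ifs <;> simp
  · dsimp only
    split_ifs with h
    · rw [abs_of_nonneg h, one_mul]
    · rw [abs_of_neg (not_le.mp h), neg_one_mul]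

theorem signs_dotProduct_le_sum_abs {m : Type*} [Fintype m] {y : m → ℝ}
    (hy : ∀ i, y i = 1 ∨ y i = -1) (x : m → ℝ) : y ⬝ᵥ x ≤ ∑ i, |x i| := by
  refine Finset.sum_le_sum fun i _ => ?_
  rcases hy i with h | h <;> rw [h]
  · simpa using le_abs_self (x i)
  · simpa using neg_le_abs (x i)

/-- For `A` symmetric of strict negative type on `F` and not of negative type on
`ℝⁿ`, the gap `Γ` of `A` on `F` equals `2/β` with `β = max_{x ∈ {−1,1}ⁿ} ⟨Bx,x⟩`, where
`B = ⟨A⁻¹u,u⟩⁻¹·(A⁻¹u)(A⁻¹u)ᵀ − A⁻¹`. -/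
theorem gap_eq_two_div_max_signs {n : ℕ} (u : Fin n → ℝ) (hu : u ≠ 0)
    (A : Matrix (Fin n) (Fin n) ℝ) (hA : A.IsSymm)
    (hneg : ∀ x : Fin n → ℝ, x ⬝ᵥ u = 0 → A.mulVec x ⬝ᵥ x ≤ 0)
    (hstrict : ∀ x : Fin n → ℝ, x ⬝ᵥ u = 0 → A.mulVec x ⬝ᵥ x = 0 → x = 0)
    (hnot : ∃ w : Fin n → ℝ, 0 < A.mulVec w ⬝ᵥ w)
    (B : Matrix (Fin n) (Fin n) ℝ)
    (hB : B = (A⁻¹.mulVec u ⬝ᵥ u)⁻¹ • vecMulVec (A⁻¹.mulVec u) (A⁻¹.mulVec u) - A⁻¹) :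
    sSup (gapSet u A) =
      2 / sSup {r : ℝ | ∃ x : Fin n → ℝ, (∀ i, x i = 1 ∨ x i = -1) ∧
        r = B.mulVec x ⬝ᵥ x} := by
  have hdet := isUnit_det_of_strict_negative_type hA hneg hstrict hnot
  set v := A⁻¹ *ᵥ u with hv
  have hAinv (y : Fin n → ℝ) : A *ᵥ (A⁻¹ *ᵥ y) = y := by
    rw [mulVec_mulVec, mul_nonsing_inv A hdet, one_mulVec]
  have hc : v ⬝ᵥ u ≠ 0 := by
    intro h
    have hv0 : v = 0 := hstrict v h (by rw [hv, hAinv, ← hv, dotProduct_comm, h])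
    apply hu
    rw [← hAinv u, ← hv, hv0, mulVec_zero]
  have hBy (y : Fin n → ℝ) :
      B *ᵥ y = ((v ⬝ᵥ u)⁻¹ * (v ⬝ᵥ y)) • v - A⁻¹ *ᵥ y := by
    rw [hB, sub_mulVec, smul_mulVec, vecMulVec_mulVec]
    simp [smul_smul]
  have hAinvSymm : A⁻¹.IsSymm := by rw [IsSymm, transpose_nonsing_inv, hA.eq]
  have hBF (y : Fin n → ℝ) : B *ᵥ y ⬝ᵥ u = 0 := by
    rw [hBy, sub_dotProduct, smul_dotProduct, hAinvSymm.mulVec_dotProduct_comm y u, ← hv,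
      smul_eq_mul]
    field_simp
    ring
  have hABy (y x : Fin n → ℝ) (hx : x ⬝ᵥ u = 0) : A *ᵥ (B *ᵥ y) ⬝ᵥ x = -(y ⬝ᵥ x) := by
    rw [hBy, mulVec_sub, mulVec_smul, hAinv, hv, hAinv, sub_dotProduct, smul_dotProduct,
      dotProduct_comm u x, hx, smul_zero, zero_sub]
  have hQ (y : Fin n → ℝ) : A *ᵥ (B *ᵥ y) ⬝ᵥ (B *ᵥ y) = -(B *ᵥ y ⬝ᵥ y) := by
    rw [hABy y _ (hBF y), dotProduct_comm]
  set S := {r : ℝ | ∃ x : Fin n → ℝ, (∀ i, x i = 1 ∨ x i = -1) ∧ r = B *ᵥ x ⬝ᵥ x} with hS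
  have hfin : S.Finite := finite_setOf_signs_quadratic B
  have hne : S.Nonempty := ⟨_, fun _ => 1, fun _ => Or.inl rfl, rfl⟩
  obtain ⟨y, hy, hβ⟩ := hne.csSup_mem hfin
  set β := sSup S
  have hβ0 : 0 ≤ β := by
    have := hneg _ (hBF y)
    rw [hQ] at this
    linarith
  have hnorm (x : Fin n → ℝ) (hx : x ⬝ᵥ u = 0) :
      (∑ i, |x i|) ^ 2 ≤ β * -(A *ᵥ x ⬝ᵥ x) := by
    obtain ⟨s, hs, hsx⟩ := exists_signs_dotProduct_eq_sum_abs x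
    have hle : B *ᵥ s ⬝ᵥ s ≤ β := le_csSup hfin.bddAbove ⟨s, hs, rfl⟩
    have hcs := sq_mulVec_dotProduct_le hA hneg hx (hBF s)
    rw [hABy s x hx, hQ, hsx] at hcs
    have := mul_le_mul_of_nonneg_right hle (neg_nonneg.mpr (hneg x hx))
    linarith
  rcases hβ0.eq_or_lt with h0 | hpos
  · have hgap : gapSet u A = Set.Ici 0 := by
      ext G
      refine ⟨fun h => h.1, fun h => ⟨h, fun x hx => ?_⟩⟩
      have h1 := hnorm x hx
      rw [← h0, zero_mul] at h1
      rw [le_antisymm h1 (sq_nonneg _), mul_zero, zero_add]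
      exact hneg x hx
    rw [hgap, ← h0, div_zero, Real.sSup_of_not_bddAbove (not_bddAbove_Ici 0)]
  · refine IsGreatest.csSup_eq ⟨⟨by positivity, fun x hx => ?_⟩, fun G hG => ?_⟩
    · have h1 := hnorm x hx
      have h2 : 2 / β / 2 * (∑ i, |x i|) ^ 2 ≤ -(A *ᵥ x ⬝ᵥ x) := by
        rw [show 2 / β / 2 * (∑ i, |x i|) ^ 2 = (∑ i, |x i|) ^ 2 / β by ring, div_le_iff₀' hpos]
        exact h1
      linarith
    · have h1 := hG.2 _ (hBF y)
      rw [hQ, ← hβ] at h1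
      have h2 := signs_dotProduct_le_sum_abs hy (B *ᵥ y)
      rw [dotProduct_comm, ← hβ] at h2
      have h3 := mul_le_mul_of_nonneg_left (pow_le_pow_left₀ hβ0 h2 2) (div_nonneg hG.1 zero_le_two)
      rw [le_div_iff₀ hpos]
      nlinarith
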